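/- arXiv:1602.00249 — 2 statements merged into one kernel-verified Lean document; each statement's English description precedes it below -/
import Mathlib

section
/- Let N₁ and N₂ be nilpotent infinitesimal isometries of Q. Then there exists g ∈ Aut(V, Q) with g ∘ N₁ ∘ g⁻¹ = N₂ if and only if rank(N₁^k) = rank(N₂^k) for every integer k ≥ 1. (This expresses that the Ad Aut(V,Q)-orbits of nilpotent elements of the orthogonal Lie algebra are classified by the Jordan partition.) -/
open Polynomial in
/-- In a finite-dimensional commutative algebra over an algebraically closed field of
characteristic different from two, every unit is a square. -/
theorem IsUnit.exists_sq_eq_of_isAlgClosed {K A : Type*} [Field K] [IsAlgClosed K]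
    [CommRing A] [Algebra K A] [FiniteDimensional K A] (h2 : (2 : K) ≠ 0)
    {b : A} (hb : IsUnit b) : ∃ r : A, r ^ 2 = b := by
  classical
  choose sqrt hsqrt using fun x : K => IsAlgClosed.exists_pow_nat_eq x two_pos
  have hint : IsIntegral K b := Algebra.IsIntegral.isIntegral b
  set m := minpoly K b with hm
  set q : K[X] := Lagrange.interpolate m.roots.toFinset id sqrt with hq
  have hprod : m = (m.roots.map (X - C ·)).prod :=
    (IsAlgClosed.splits m).eq_prod_roots_of_monic (minpoly.monic hint)
  have hdvd : m ∣ (q ^ 2 - X) ^ Multiset.card m.roots := by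
    rw [← Multiset.prod_replicate, ← Multiset.map_const']
    refine hprod.dvd.trans (Multiset.prod_dvd_prod_of_dvd _ _ fun a ha => ?_)
    have hqa : q.eval a = sqrt a := Lagrange.eval_interpolate_at_node (v := id) sqrt
      Function.injective_id.injOn (Multiset.mem_toFinset.mpr ha)
    simp [dvd_iff_isRoot, hqa, hsqrt]
  have hnil : IsNilpotent (aeval b q ^ 2 - b) := by
    refine ⟨Multiset.card m.roots, ?_⟩
    obtain ⟨c, hc⟩ := hdvd
    have := congrArg (aeval b) hc
    simpa [hm] using this
  have hsq : IsUnit (aeval b q ^ 2) := by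
    simpa using hnil.isUnit_add_right_of_commute hb (Commute.all _ _)
  have hx : IsUnit (aeval b q) := (isUnit_pow_iff two_ne_zero).mp hsq
  have htwo : IsUnit (2 : A) := by
    simpa only [map_ofNat] using (IsUnit.mk0 (2 : K) h2).map (algebraMap K A)
  obtain ⟨r, ⟨-, hr⟩, -⟩ := existsUnique_nilpotent_sub_and_aeval_eq_zero
    (P := (X ^ 2 - C b : A[X])) (x := aeval b q) (by simpa using hnil)
    (by simpa [one_add_one_eq_two] using htwo.mul hx)
  exact ⟨r, by simpa [sub_eq_zero] using hr⟩

theorem Module.End.exists_sq_eq_of_injective {K V : Type*} [Field K] [IsAlgClosed K]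
    [AddCommGroup V] [Module K V] [FiniteDimensional K V] (h2 : (2 : K) ≠ 0)
    {s : Module.End K V} (hs : Function.Injective s) :
    ∃ r ∈ Algebra.adjoin K {s}, r ^ 2 = s := by
  let s' : Algebra.adjoin K {s} := ⟨s, Algebra.self_mem_adjoin_singleton K s⟩
  have : IsArtinianRing (Algebra.adjoin K {s}) := IsArtinianRing.of_finite K _
  have hs' : IsUnit s' := by
    refine IsArtinianRing.isUnit_of_mem_nonZeroDivisors
      (mem_nonZeroDivisors_iff_left.mpr fun x hx => ?_)
    ext v
    have := congrArg (fun y : Algebra.adjoin K {s} => (y : Module.End K V) v) hx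
    exact hs (by simpa [s'] using this)
  obtain ⟨r, hr⟩ := hs'.exists_sq_eq_of_isAlgClosed h2
  exact ⟨r, r.2, by simpa using congrArg Subtype.val hr⟩

section Gluing

variable {K V V' : Type*} [Field K] [AddCommGroup V] [Module K V] [AddCommGroup V'] [Module K V']

theorem Submodule.exists_linearMap_of_disjoint {p q : Submodule K V} (h : Disjoint p q)
    (f : p →ₗ[K] V') (g : q →ₗ[K] V') :
    ∃ c : V →ₗ[K] V', (∀ x : p, c x = f x) ∧ ∀ x : q, c x = g x := by
  obtain ⟨d, hpd, hd⟩ := h.exists_isCompl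
  obtain ⟨f', hf'⟩ := f.exists_extend
  obtain ⟨g', hg'⟩ := g.exists_extend
  refine ⟨LinearMap.ofIsCompl hd (f' ∘ₗ d.subtype) (g' ∘ₗ q.subtype), fun x => ?_, fun x => ?_⟩
  · have := LinearMap.ofIsCompl_apply_left hd (φ := f' ∘ₗ d.subtype) (ψ := g' ∘ₗ q.subtype)
      ⟨x, hpd x.2⟩
    simpa [← hf'] using this
  · simp [← hg']

/-- The restriction of an endomorphism to its range. -/
def Module.End.restrictRange (N : Module.End K V) : Module.End K (LinearMap.range N) :=
  N.rangeRestrict ∘ₗ (LinearMap.range N).subtype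

@[simp]
theorem Module.End.coe_restrictRange_apply (N : Module.End K V) (x : LinearMap.range N) :
    (N.restrictRange x : V) = N x := rfl

theorem Module.End.coe_restrictRange_pow_apply (N : Module.End K V) (k : ℕ)
    (x : LinearMap.range N) : ((N.restrictRange ^ k) x : V) = (N ^ k) x := by
  induction k with
  | zero => simp
  | succ k ih => simp [pow_succ', ih]

theorem Module.End.map_range_restrictRange_pow (N : Module.End K V) (k : ℕ) :
    (LinearMap.range (N.restrictRange ^ k)).map (LinearMap.range N).subtype =
      LinearMap.range (N ^ (k + 1)) := by
  ext v
  constructor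
  · rintro ⟨_, ⟨⟨_, w, rfl⟩, rfl⟩, rfl⟩
    exact ⟨w, by simp [Module.End.coe_restrictRange_pow_apply, pow_succ]⟩
  · rintro ⟨w, rfl⟩
    exact ⟨_, ⟨N.rangeRestrict w, rfl⟩,
      by simp [Module.End.coe_restrictRange_pow_apply, pow_succ]⟩

theorem Module.End.finrank_range_pow_zero (N : Module.End K V) :
    Module.finrank K (LinearMap.range (N ^ 0)) = Module.finrank K V := by
  rw [show N ^ 0 = LinearMap.id from pow_zero N, LinearMap.range_id, finrank_top]

theorem Module.End.finrank_range_restrictRange_pow (N : Module.End K V) (k : ℕ) :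
    Module.finrank K (LinearMap.range (N.restrictRange ^ k)) =
      Module.finrank K (LinearMap.range (N ^ (k + 1))) := by
  rw [← N.map_range_restrictRange_pow k]
  exact (LinearEquiv.finrank_eq (Submodule.equivMapOfInjective _
    (Submodule.injective_subtype _) _))

theorem Module.End.finrank_range_inf_ker [FiniteDimensional K V] (N : Module.End K V) :
    Module.finrank K (LinearMap.range N ⊓ LinearMap.ker N : Submodule K V) +
      Module.finrank K (LinearMap.range (N ^ 2)) = Module.finrank K (LinearMap.range N) := by
  have hker : (LinearMap.ker N.restrictRange).map (LinearMap.range N).subtype =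
      LinearMap.range N ⊓ LinearMap.ker N := by
    ext v
    simp [Submodule.mem_map, Subtype.ext_iff, and_comm]
  have h := LinearMap.finrank_range_add_finrank_ker N.restrictRange
  have h1 := N.finrank_range_restrictRange_pow 1
  rw [pow_one] at h1
  rw [← hker, ← h, ← h1, add_comm]
  congr 1
  exact (LinearEquiv.finrank_eq (Submodule.equivMapOfInjective _
    (Submodule.injective_subtype _) _)).symm

/-- An intertwiner between the ranges of two endomorphisms extends to the whole spaces when the
powers of the endomorphisms have the same ranks. -/
theorem Module.End.exists_intertwiner_extending [FiniteDimensional K V] [FiniteDimensional K V']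
    {N : Module.End K V} {N' : Module.End K V'}
    (hrank : ∀ k, Module.finrank K (LinearMap.range (N ^ k)) =
      Module.finrank K (LinearMap.range (N' ^ k)))
    (e₀ : LinearMap.range N ≃ₗ[K] LinearMap.range N')
    (he₀ : ∀ x, e₀ (N.restrictRange x) = N'.restrictRange (e₀ x)) :
    ∃ e : V ≃ₗ[K] V', ∀ v, e (N v) = N' (e v) := by
  have hdim : Module.finrank K V = Module.finrank K V' := by
    simpa only [Module.End.finrank_range_pow_zero] using hrank 0
  have hr1 := hrank 1
  rw [pow_one, pow_one] at hr1
  obtain ⟨C, hC, hCsup⟩ := IsModularLattice.exists_disjoint_and_sup_eq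
    (inf_le_right : LinearMap.range N ⊓ LinearMap.ker N ≤ LinearMap.ker N)
  obtain ⟨C', hC', hCsup'⟩ := IsModularLattice.exists_disjoint_and_sup_eq
    (inf_le_right : LinearMap.range N' ⊓ LinearMap.ker N' ≤ LinearMap.ker N')
  have hCker : C ≤ LinearMap.ker N := hCsup ▸ le_sup_right
  have hCker' : C' ≤ LinearMap.ker N' := hCsup' ▸ le_sup_right
  have hdisj : Disjoint (LinearMap.range N) C := by
    rw [disjoint_iff] at hC ⊢
    rwa [inf_assoc, inf_eq_right.mpr hCker] at hC
  have hdisj' : Disjoint (LinearMap.range N') C' := by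
    rw [disjoint_iff] at hC' ⊢
    rwa [inf_assoc, inf_eq_right.mpr hCker'] at hC'
  have hfin : Module.finrank K C = Module.finrank K C' := by
    have a := Submodule.finrank_sup_add_finrank_inf_eq (LinearMap.range N ⊓ LinearMap.ker N) C
    have a' := Submodule.finrank_sup_add_finrank_inf_eq (LinearMap.range N' ⊓ LinearMap.ker N') C'
    rw [hCsup, hC.eq_bot, finrank_bot] at a
    rw [hCsup', hC'.eq_bot, finrank_bot] at a'
    have := N.finrank_range_inf_ker
    have := N'.finrank_range_inf_ker
    have := LinearMap.finrank_range_add_finrank_ker N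
    have := LinearMap.finrank_range_add_finrank_ker N'
    have := hrank 2
    omega
  let κ : C ≃ₗ[K] C' := LinearEquiv.ofFinrankEq _ _ hfin
  obtain ⟨l, hl⟩ := Module.projective_lifting_property N'.rangeRestrict
    ((e₀ : LinearMap.range N →ₗ[K] LinearMap.range N') ∘ₗ N.rangeRestrict)
    N'.surjective_rangeRestrict
  replace hl : ∀ v, N' (l v) = e₀ (N.rangeRestrict v) := fun v =>
    congrArg Subtype.val (LinearMap.congr_fun hl v)
  obtain ⟨c, hcr, hck⟩ := Submodule.exists_linearMap_of_disjoint hdisj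
    (LinearMap.codRestrict (LinearMap.ker N')
      ((LinearMap.range N').subtype ∘ₗ (e₀ : LinearMap.range N →ₗ[K] LinearMap.range N') -
        l ∘ₗ (LinearMap.range N).subtype) fun x => by
          have := congrArg Subtype.val (he₀ x)
          rw [LinearMap.mem_ker, LinearMap.sub_apply, map_sub, sub_eq_zero]
          exact this.symm.trans (hl x).symm)
    (LinearMap.codRestrict (LinearMap.ker N')
      (C'.subtype ∘ₗ (κ : C →ₗ[K] C') - l ∘ₗ C.subtype) fun x => by
          have h : N.rangeRestrict x = 0 := Subtype.ext (hCker x.2)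
          have h' : N' (κ x) = 0 := hCker' (κ x).2
          simp [hl, h, h'])
  let f : V →ₗ[K] V' := l + (LinearMap.ker N').subtype ∘ₗ c
  have hfr (x : LinearMap.range N) : f x = e₀ x := by simp [f, hcr]
  have hfk (x : C) : f x = κ x := by
    rw [LinearMap.add_apply, LinearMap.comp_apply, hck]
    exact add_sub_cancel (l x) (κ x : V')
  have hNf (v : V) : N' (f v) = e₀ (N.rangeRestrict v) := by
    simp [f, hl]
  have hinj : Function.Injective f := by
    refine (injective_iff_map_eq_zero f).mpr fun v hv => ?_
    have h0 : N.rangeRestrict v = 0 := by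
      have := hNf v
      rw [hv, map_zero] at this
      exact e₀.map_eq_zero_iff.mp (Subtype.ext this.symm)
    have hvker : v ∈ LinearMap.ker N := congrArg Subtype.val h0
    rw [← hCsup] at hvker
    obtain ⟨x, hx, y, hy, rfl⟩ := Submodule.mem_sup.mp hvker
    have hxy : (e₀ ⟨x, hx.1⟩ : V') + κ ⟨y, hy⟩ = 0 := by
      rw [← hfr, ← hfk, ← map_add, hv]
    have hx0 : (e₀ ⟨x, hx.1⟩ : V') = 0 := by
      refine Submodule.disjoint_def.mp hdisj' _ (e₀ _).2 ?_
      rw [eq_neg_of_add_eq_zero_left hxy]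
      exact C'.neg_mem (κ _).2
    have hy0 : (κ ⟨y, hy⟩ : V') = 0 := by rwa [hx0, zero_add] at hxy
    have hx1 : x = 0 := congrArg Subtype.val (e₀.map_eq_zero_iff.mp (Subtype.ext hx0))
    have hy1 : y = 0 := congrArg Subtype.val (κ.map_eq_zero_iff.mp (Subtype.ext hy0))
    rw [hx1, hy1, add_zero]
  refine ⟨LinearEquiv.ofInjectiveOfFinrankEq f hinj hdim, fun v => ?_⟩
  exact (hfr (N.rangeRestrict v)).trans (hNf v).symm

end Gluing

/-- Nilpotent endomorphisms all of whose powers have the same ranks are similar. -/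
theorem Module.End.exists_intertwiner_of_finrank_range_pow_eq {K : Type*} [Field K] (n : ℕ) :
    ∀ {V V' : Type*} [AddCommGroup V] [Module K V] [AddCommGroup V'] [Module K V']
      [FiniteDimensional K V] [FiniteDimensional K V']
      {N : Module.End K V} {N' : Module.End K V'}, N ^ n = 0 →
      (∀ k, Module.finrank K (LinearMap.range (N ^ k)) =
        Module.finrank K (LinearMap.range (N' ^ k))) →
      ∃ e : V ≃ₗ[K] V', ∀ v, e (N v) = N' (e v) := by
  induction n with
  | zero =>
    intro V V' _ _ _ _ _ _ N N' hN hrank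
    have hdim : Module.finrank K V = Module.finrank K V' := by
      simpa only [Module.End.finrank_range_pow_zero] using hrank 0
    have hzero (v : V) : v = 0 := LinearMap.congr_fun hN v
    have : Subsingleton V := ⟨fun a b => (hzero a).trans (hzero b).symm⟩
    let e := LinearEquiv.ofFinrankEq V V' hdim
    have : Subsingleton V' := e.symm.toEquiv.subsingleton
    exact ⟨e, fun v => Subsingleton.elim _ _⟩
  | succ n ih =>
    intro V V' _ _ _ _ _ _ N N' hN hrank
    obtain ⟨e₀, he₀⟩ := ih (N := N.restrictRange) (N' := N'.restrictRange)
      (by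
        ext ⟨x, y, rfl⟩
        rw [Module.End.coe_restrictRange_pow_apply]
        simpa [pow_succ] using LinearMap.congr_fun hN y)
      (fun k => by simp only [Module.End.finrank_range_restrictRange_pow, hrank])
    exact Module.End.exists_intertwiner_extending hrank e₀ he₀

/-- Similar infinitesimal isometries of a nondegenerate symmetric bilinear form are conjugate
under an isometry. -/
theorem LinearMap.exists_isometry_intertwiner {K V : Type*} [Field K] [IsAlgClosed K]
    [AddCommGroup V] [Module K V] [FiniteDimensional K V] (h2 : (2 : K) ≠ 0)
    {Q : V →ₗ[K] V →ₗ[K] K} (hnd : ∀ u : V, (∀ v : V, Q u v = 0) → u = 0)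
    (hsymm : ∀ u v : V, Q u v = Q v u) {N₁ N₂ : Module.End K V}
    (h₁ : ∀ u v : V, Q (N₁ u) v + Q u (N₁ v) = 0)
    (h₂ : ∀ u v : V, Q (N₂ u) v + Q u (N₂ v) = 0)
    (e : V ≃ₗ[K] V) (he : ∀ v, e (N₁ v) = N₂ (e v)) :
    ∃ g : V ≃ₗ[K] V, (∀ u v : V, Q (g u) (g v) = Q u v) ∧ ∀ v, g (N₁ v) = N₂ (g v) := by
  have hQinj : Function.Injective Q := (injective_iff_map_eq_zero Q).mpr fun u hu =>
    hnd u fun v => by simp [hu]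
  let D : V ≃ₗ[K] (V →ₗ[K] K) := LinearEquiv.ofInjectiveOfFinrankEq Q hQinj
    (Subspace.dual_finrank_eq (K := K) (V := V)).symm
  let s : Module.End K V := (D.symm : (V →ₗ[K] K) →ₗ[K] V) ∘ₗ
    (Q.compl₁₂ (e : V →ₗ[K] V) (e : V →ₗ[K] V))
  have hs (u v : V) : Q (s u) v = Q (e u) (e v) :=
    LinearMap.congr_fun (D.apply_symm_apply (Q.compl₁₂ (e : V →ₗ[K] V) (e : V →ₗ[K] V) u)) v
  have hsinj : Function.Injective s := by
    refine (injective_iff_map_eq_zero s).mpr fun u hu => e.map_eq_zero_iff.mp (hnd _ fun v => ?_)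
    rw [← e.apply_symm_apply v, ← hs, hu, map_zero, LinearMap.zero_apply]
  have hscomm : Commute s N₁ := by
    refine LinearMap.ext fun u => hQinj (LinearMap.ext fun v => ?_)
    have a := h₂ (e u) (e v)
    have b := h₁ (s u) v
    rw [← he, ← he, ← hs, ← hs] at a
    exact add_right_cancel (a.trans b.symm)
  obtain ⟨r, hr, hrs⟩ := Module.End.exists_sq_eq_of_injective h2 hsinj
  have hrcomm : Commute r N₁ :=
    (Algebra.commute_of_mem_adjoin_singleton_of_commute hr hscomm.symm).symm
  have hradj (u v : V) : Q (r u) v = Q u (r v) := by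
    clear hrs hrcomm
    induction hr using Algebra.adjoin_induction generalizing u v with
    | mem x hx =>
      obtain rfl := hx
      rw [hs, hsymm u, hs, hsymm]
    | algebraMap c => simp [Module.algebraMap_end_apply]
    | add x y _ _ hx hy => simp [hx, hy]
    | mul x y hxm hym hx hy =>
      have hxy : x * y = y * x := congrArg Subtype.val
        (mul_comm (⟨x, hxm⟩ : Algebra.adjoin K {s}) ⟨y, hym⟩)
      rw [Module.End.mul_apply, hx, hy, hxy, Module.End.mul_apply]
  have hrr (v : V) : r (r v) = s v := by rw [← hrs, pow_two, Module.End.mul_apply]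
  have hrinj : Function.Injective r := fun a b hab => hsinj (by rw [← hrr, ← hrr, hab])
  let ρ : V ≃ₗ[K] V := LinearEquiv.ofInjectiveEndo r hrinj
  have hρ (v : V) : r (ρ.symm v) = v := ρ.apply_symm_apply v
  refine ⟨ρ.symm.trans e, fun u v => ?_, fun v => ?_⟩
  · simp only [LinearEquiv.trans_apply]
    rw [← hs, ← hrr, hradj, hρ, hρ]
  · simp only [LinearEquiv.trans_apply]
    rw [← he]
    congr 1
    apply hrinj
    rw [hρ, ← Module.End.mul_apply, hrcomm.eq, Module.End.mul_apply, hρ]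

theorem LinearMap.finrank_range_pow_eq_of_intertwiner {K V : Type*} [Field K]
    [AddCommGroup V] [Module K V] {N₁ N₂ : Module.End K V} (e : V ≃ₗ[K] V)
    (he : ∀ v, e (N₁ v) = N₂ (e v)) (k : ℕ) :
    Module.finrank K (LinearMap.range (N₁ ^ k)) = Module.finrank K (LinearMap.range (N₂ ^ k)) := by
  have hpow (v : V) : e ((N₁ ^ k) v) = (N₂ ^ k) (e v) := by
    induction k with
    | zero => simp
    | succ k ih => simp [pow_succ', he, ih]
  have hrange : (LinearMap.range (N₁ ^ k)).map (e : V →ₗ[K] V) = LinearMap.range (N₂ ^ k) := by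
    ext v
    constructor
    · rintro ⟨_, ⟨w, rfl⟩, rfl⟩
      exact ⟨e w, (hpow w).symm⟩
    · rintro ⟨w, rfl⟩
      exact ⟨_, ⟨e.symm w, rfl⟩, by simp [hpow]⟩
  rw [← hrange]
  exact (LinearEquiv.finrank_map_eq e _).symm


/-- For a nondegenerate symmetric bilinear form `Q` on a
finite-dimensional complex vector space `V`, two nilpotent infinitesimal isometries `N₁, N₂`
of `Q` are conjugate by an element of `Aut(V, Q)` if and only if `rank (N₁^k) = rank (N₂^k)`
for every `k ≥ 1`: the `Ad Aut(V,Q)`-orbits of nilpotent elements of the orthogonal Lie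
algebra are classified by the Jordan partition. -/
theorem stmt3 {V : Type} [AddCommGroup V] [Module ℂ V] [FiniteDimensional ℂ V]
    (Q : V →ₗ[ℂ] V →ₗ[ℂ] ℂ)
    (hQnd : ∀ u : V, (∀ v : V, Q u v = 0) → u = 0)
    (hQsymm : ∀ u v : V, Q u v = Q v u)
    (N₁ N₂ : Module.End ℂ V)
    (hN₁nil : IsNilpotent N₁) (hN₂nil : IsNilpotent N₂)
    (hN₁iso : ∀ u v : V, Q (N₁ u) v + Q u (N₁ v) = 0)
    (hN₂iso : ∀ u v : V, Q (N₂ u) v + Q u (N₂ v) = 0) :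
    (∃ g : V ≃ₗ[ℂ] V, (∀ u v : V, Q (g u) (g v) = Q u v) ∧
        (g : V →ₗ[ℂ] V) ∘ₗ N₁ ∘ₗ (g.symm : V →ₗ[ℂ] V) = N₂) ↔
      (∀ k : ℕ, 1 ≤ k →
        Module.finrank ℂ (LinearMap.range (N₁ ^ k)) =
          Module.finrank ℂ (LinearMap.range (N₂ ^ k))) := by
  constructor
  · rintro ⟨g, -, hg⟩ k -
    refine LinearMap.finrank_range_pow_eq_of_intertwiner g (fun v => ?_) k
    simpa using LinearMap.congr_fun hg (g v)
  · intro hrank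
    obtain ⟨n, hn⟩ := hN₁nil
    obtain ⟨e, he⟩ := Module.End.exists_intertwiner_of_finrank_range_pow_eq (N' := N₂) n hn
      fun k => by
        rcases k.eq_zero_or_pos with rfl | hk
        · rw [Module.End.finrank_range_pow_zero, Module.End.finrank_range_pow_zero]
        · exact hrank k hk
    obtain ⟨g, hgQ, hg⟩ :=
      LinearMap.exists_isometry_intertwiner two_ne_zero hQnd hQsymm hN₁iso hN₂iso e he
    exact ⟨g, hgQ, LinearMap.ext fun v => by simp [hg]⟩
end

section
/- Let N be a nilpotent infinitesimal isometry of Q. For d ≥ 1 the number of Jordan blocks of N of size d equals m_d = rank(N^{d−1}) − 2·rank(N^d) + rank(N^{d+1}) (with N⁰ = id). Then m_d is even for every even integer d ≥ 2; that is, the even parts of the Jordan partition of a nilpotent element of the orthogonal Lie algebra occur with even multiplicity. -/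
/-- A nondegenerate skew-symmetric bilinear form lives on an even-dimensional space. -/
theorem even_finrank_of_skew {W : Type*} [AddCommGroup W] [Module ℂ W] [FiniteDimensional ℂ W]
    (B : W →ₗ[ℂ] W →ₗ[ℂ] ℂ) (hnd : ∀ u, (∀ v, B u v = 0) → u = 0)
    (hskew : ∀ u v, B u v = -B v u) : Even (Module.finrank ℂ W) := by
  let b := Module.finBasis ℂ W
  set A := LinearMap.toMatrix₂ b b B with hA
  have hdet : A.det ≠ 0 :=
    (LinearMap.separatingLeft_iff_det_ne_zero b).1 hnd
  have hT : A.transpose = -A := by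
    ext i j
    simp only [hA, Matrix.transpose_apply, Matrix.neg_apply, LinearMap.toMatrix₂_apply]
    exact hskew _ _
  by_contra hodd
  have h := congrArg Matrix.det hT
  rw [Matrix.det_transpose, Matrix.det_neg, Fintype.card_fin,
    (Nat.not_even_iff_odd.1 hodd).neg_one_pow, neg_one_mul] at h
  exact hdet (self_eq_neg.1 h)

/-- An endomorphism that is skew-adjoint for a nondegenerate symmetric form has even rank. -/
theorem even_finrank_range_of_skewAdjoint {V : Type*} [AddCommGroup V] [Module ℂ V]
    [FiniteDimensional ℂ V] (Q : V →ₗ[ℂ] V →ₗ[ℂ] ℂ)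
    (hnd : ∀ u, (∀ v, Q u v = 0) → u = 0) (hsymm : ∀ u v, Q u v = Q v u)
    (M : Module.End ℂ V) (hM : ∀ u v, Q (M u) v = -Q u (M v)) :
    Even (Module.finrank ℂ (LinearMap.range M)) := by
  obtain ⟨W, hW⟩ := Submodule.exists_isCompl (LinearMap.ker M)
  have hrank : Module.finrank ℂ (LinearMap.range M) = Module.finrank ℂ W := by
    have h₁ := LinearMap.finrank_range_add_finrank_ker M
    have h₂ := Submodule.finrank_add_eq_of_isCompl hW
    omega
  rw [hrank]
  refine even_finrank_of_skew ((Q ∘ₗ M).compl₁₂ W.subtype W.subtype) (fun u hu => ?_)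
    (fun u v => ?_)
  · have hMu : M u = 0 := by
      refine hnd _ fun v => ?_
      obtain ⟨k, hk, w, hw, rfl⟩ := Submodule.mem_sup.1
        (hW.sup_eq_top ▸ Submodule.mem_top : v ∈ LinearMap.ker M ⊔ W)
      have hw' : Q (M u) w = 0 := hu ⟨w, hw⟩
      rw [map_add, hw', hM, LinearMap.mem_ker.1 hk, map_zero, neg_zero, add_zero]
    exact Subtype.ext (Submodule.disjoint_def.1 hW.disjoint u (LinearMap.mem_ker.2 hMu) u.2)
  · change Q (M u) v = -Q (M v) u
    rw [hM, hsymm]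

/-- Powers of an infinitesimal isometry are self-adjoint up to the sign `(-1) ^ k`. -/
theorem apply_pow_eq_neg_one_pow_mul {V : Type*} [AddCommGroup V] [Module ℂ V]
    (Q : V →ₗ[ℂ] V →ₗ[ℂ] ℂ) (N : Module.End ℂ V)
    (hN : ∀ u v, Q (N u) v + Q u (N v) = 0) (k : ℕ) (u v : V) :
    Q ((N ^ k) u) v = (-1) ^ k * Q u ((N ^ k) v) := by
  induction k generalizing u v with
  | zero => simp
  | succ k ih =>
    rw [pow_succ, Module.End.mul_apply, ih, eq_neg_of_add_eq_zero_left (hN u _),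
      ← Module.End.mul_apply N, ← pow_succ', ← pow_succ]
    ring


/-- Let `Q` be a nondegenerate symmetric bilinear form on a finite-dimensional
complex vector space and `N` a nilpotent infinitesimal isometry of `Q`.  For `d ≥ 1` the number
of Jordan blocks of `N` of size `d` is `m_d = rank (N^(d-1)) - 2 rank (N^d) + rank (N^(d+1))`
(with `N^0 = id`).  Then `m_d` is even for every even `d ≥ 2`: even parts of the Jordan
partition of a nilpotent element of the orthogonal Lie algebra occur with even multiplicity. -/
theorem stmt4 {V : Type} [AddCommGroup V] [Module ℂ V] [FiniteDimensional ℂ V]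
    (Q : V →ₗ[ℂ] V →ₗ[ℂ] ℂ)
    (hQnd : ∀ u : V, (∀ v : V, Q u v = 0) → u = 0)
    (hQsymm : ∀ u v : V, Q u v = Q v u)
    (N : Module.End ℂ V)
    (hNnil : IsNilpotent N)
    (hNiso : ∀ u v : V, Q (N u) v + Q u (N v) = 0)
    (d : ℕ) (hd : 2 ≤ d) (heven : Even d) :
    Even ((Module.finrank ℂ (LinearMap.range (N ^ (d - 1))) : ℤ)
      - 2 * (Module.finrank ℂ (LinearMap.range (N ^ d)) : ℤ)
      + (Module.finrank ℂ (LinearMap.range (N ^ (d + 1))) : ℤ)) := by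
  have heven_rank {k : ℕ} (hk : Odd k) : Even (Module.finrank ℂ (LinearMap.range (N ^ k)) : ℤ) := by
    refine (Int.even_coe_nat _).2 (even_finrank_range_of_skewAdjoint Q hQnd hQsymm _ fun u v => ?_)
    rw [apply_pow_eq_neg_one_pow_mul Q N hNiso, hk.neg_one_pow, neg_one_mul]
  exact ((heven_rank (Nat.Even.sub_odd (by omega) heven odd_one)).sub (even_two_mul _)).add
    (heven_rank heven.add_one)
end
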